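/- Let p ≥ 1 and, for a global weak solution u, set E(r) = ∫_{Q_r^κ} f(|u|) dx dt. For every κ > 0 there exist constants C > 0 and σ > 0, depending only on A, k, m, n, p and κ, such that for every global weak solution u of the problem and all R > 0 at least one of the following two systems of inequalities holds. System (I): ( (mes(Q_R^κ \ Q_{R/2}^κ))^{−1} ∫_{Q_R^κ \ Q_{R/2}^κ} |u|^p dx dt )^{1/p} ≥ σ R^{−(n−(k−1)κ)} E(R/2) and E(R) − E(R/2) ≥ C R^{n+κ} f( σ E(R/2) / R^{n−(k−1)κ} ). System (II): (mes(Q_R^κ \ Q_{R/2}^κ))^{−1} ∫_{Q_R^κ \ Q_{R/2}^κ} |u|^p dx dt ≥ σ R^{−(n+κ−m)} E(R/2) and E(R) − E(R/2) ≥ C R^{n+κ} f( ( σ E(R/2) / R^{n+κ−m} )^{1/p} ). -/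

import Mathlib

open MeasureTheory Real Set Filter

noncomputable section

/-- The spatial domain `ℝⁿ`. -/
abbrev Spc (n : ℕ) := EuclideanSpace ℝ (Fin n)

/-- The open ball `B_r` in `ℝⁿ` of radius `r` centered at `0`. -/
def ball0 (n : ℕ) (r : ℝ) : Set (Spc n) := Metric.ball 0 r

/-- The cylinder `Q_r^κ = B_r × (0, r^κ)`. -/
def cyl (n : ℕ) (r κ : ℝ) : Set (Spc n × ℝ) := ball0 n r ×ˢ Ioo 0 (r ^ κ)

/-- The half-space `ℝ^{n+1}_+ = ℝⁿ × (0, ∞)`. -/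
def halfSp (n : ℕ) : Set (Spc n × ℝ) := {z | 0 < z.2}

/-- The (finite) set of multi-indices `α` with `|α| = m`. -/
def mIdx (n m : ℕ) : Finset (Fin n → ℕ) :=
  (Fintype.piFinset fun _ : Fin n => Finset.range (m + 1)).filter fun α => ∑ i, α i = m

/-- Spatial partial derivative `∂/∂x_i`. -/
def spDeriv (n : ℕ) (i : Fin n) (φ : Spc n × ℝ → ℝ) : Spc n × ℝ → ℝ :=
  fun z => deriv (fun s : ℝ => φ (z.1 + s • EuclideanSpace.single i (1 : ℝ), z.2)) 0

/-- Time derivative `∂/∂t`. -/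
def tDeriv (n : ℕ) (φ : Spc n × ℝ → ℝ) : Spc n × ℝ → ℝ :=
  fun z => deriv (fun s : ℝ => φ (z.1, s)) z.2

/-- Multi-index spatial derivative `∂^α`. -/
def mDeriv (n : ℕ) (α : Fin n → ℕ) (φ : Spc n × ℝ → ℝ) : Spc n × ℝ → ℝ :=
  (List.finRange n).foldr (fun i ψ => (spDeriv n i)^[α i] ψ) φ

/-- Caratheodory conditions and the growth bound `|a_α(x,t,ζ)| ≤ A |ζ|^p` for the
coefficients of the operator `L`. -/
def GoodCoeffs (n m : ℕ) (A p : ℝ) (a : (Fin n → ℕ) → Spc n × ℝ → ℝ → ℝ) : Prop :=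
  ∀ α ∈ mIdx n m,
    (∀ ζ : ℝ, Measurable fun z => a α z ζ) ∧
    (∀ᵐ z ∂(volume.restrict (halfSp n)), Continuous fun ζ => a α z ζ) ∧
    (∀ᵐ z ∂(volume.restrict (halfSp n)), ∀ ζ : ℝ, |a α z ζ| ≤ A * |ζ| ^ p)

/-- The standing conditions on `f`: `ζ ↦ f ζ` and `ζ ↦ f (ζ^{1/p})` are nondecreasing
and convex on `[0,∞)`, and `f` is positive on `(0,∞)`. -/
def GoodF (p : ℝ) (f : ℝ → ℝ) : Prop :=
  MonotoneOn f (Ici 0) ∧ ConvexOn ℝ (Ici 0) f ∧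
  MonotoneOn (fun ζ => f (ζ ^ (1 / p))) (Ici 0) ∧
  ConvexOn ℝ (Ici 0) (fun ζ => f (ζ ^ (1 / p))) ∧
  ∀ ζ : ℝ, 0 < ζ → 0 < f ζ

/-- Condition (1.4): `∫_1^∞ ζ^{1/k - 1} f(ζ)^{-1/k} dζ < ∞`. -/
def Cond14 (k : ℕ) (f : ℝ → ℝ) : Prop :=
  IntegrableOn (fun ζ : ℝ => ζ ^ ((k : ℝ)⁻¹ - 1) / f ζ ^ ((k : ℝ)⁻¹)) (Ioi 1)

/-- Condition (1.5): `∫_1^∞ ζ^{p/m - 1} f(ζ)^{-1/m} dζ < ∞`. -/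
def Cond15 (m : ℕ) (p : ℝ) (f : ℝ → ℝ) : Prop :=
  IntegrableOn (fun ζ : ℝ => ζ ^ (p / (m : ℝ) - 1) / f ζ ^ ((m : ℝ)⁻¹)) (Ioi 1)

/-- `v ∈ L^1_loc(ℝⁿ)`. -/
def L1locInit (n : ℕ) (v : Spc n → ℝ) : Prop :=
  ∀ r : ℝ, 0 < r → IntegrableOn v (ball0 n r)

/-- `u` is a global weak solution of
`∂_t^k u - Σ_{|α| = m} ∂^α a_α(x,t,u) ≥ f(|u|)` in `ℝ^{n+1}_+`, with initial data
`∂_t^i u(·,0) = u0 i` for `0 ≤ i ≤ k-1`. -/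
def IsGlobalWeakSol (n k m : ℕ) (p : ℝ) (a : (Fin n → ℕ) → Spc n × ℝ → ℝ → ℝ)
    (f : ℝ → ℝ) (u0 : ℕ → Spc n → ℝ) (u : Spc n × ℝ → ℝ) : Prop :=
  (∀ r : ℝ, 0 < r → IntegrableOn u (cyl n r 1)) ∧
  (∀ r : ℝ, 0 < r → IntegrableOn (fun z => |u z| ^ p) (cyl n r 1)) ∧
  (∀ r : ℝ, 0 < r → IntegrableOn (fun z => f |u z|) (cyl n r 1)) ∧
  ∀ φ : Spc n × ℝ → ℝ, ContDiff ℝ (⊤ : ℕ∞) φ → HasCompactSupport φ →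
    (∀ z, 0 ≤ φ z) →
    (∫ z in halfSp n, (-1 : ℝ) ^ k * u z * (tDeriv n)^[k] φ z)
      - (∫ z in halfSp n, ∑ α ∈ mIdx n m, (-1 : ℝ) ^ m * a α z (u z) * mDeriv n α φ z)
    ≥ (∫ x : Spc n, ∑ i ∈ Finset.range k,
          (-1 : ℝ) ^ i * u0 (k - 1 - i) x * (tDeriv n)^[i] φ (x, 0))
      + ∫ z in halfSp n, f |u z| * φ z

/-- `u = 0` almost everywhere in `ℝ^{n+1}_+`. -/
def TrivialSol (n : ℕ) (u : Spc n × ℝ → ℝ) : Prop :=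
  ∀ᵐ z ∂(volume.restrict (halfSp n)), u z = 0

/-- The standing hypotheses of Section 3: the coefficients are Caratheodory functions
with the growth bound, `f` satisfies the monotonicity/convexity/positivity conditions
together with (1.4) and (1.5), and the initial data are locally integrable with
`u_{k-1} ≥ 0` a.e. -/
def Standing (n k m : ℕ) (A p : ℝ) (a : (Fin n → ℕ) → Spc n × ℝ → ℝ → ℝ)
    (f : ℝ → ℝ) (u0 : ℕ → Spc n → ℝ) : Prop :=
  GoodCoeffs n m A p a ∧ GoodF p f ∧
  (∀ i < k, L1locInit n (u0 i)) ∧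
  (∀ᵐ x ∂(volume : Measure (Spc n)), 0 ≤ u0 (k - 1) x) ∧
  Cond14 k f ∧ Cond15 m p f


section Derivatives

variable {n : ℕ}

/-- The anisotropic dilation `(x, t) ↦ (a x, b t)`. -/
def dilate (n : ℕ) (a b : ℝ) (z : Spc n × ℝ) : Spc n × ℝ := (a • z.1, b * z.2)

/-- Smooth functions with compact support on `ℝⁿ × ℝ`. -/
def IsTestFun (n : ℕ) (φ : Spc n × ℝ → ℝ) : Prop :=
  ContDiff ℝ (⊤ : ℕ∞) φ ∧ HasCompactSupport φ

lemma iterate_tDeriv_dilate (a b : ℝ) (φ : Spc n × ℝ → ℝ) (k : ℕ) :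
    (tDeriv n)^[k] (fun z => φ (dilate n a b z))
      = fun z => b ^ k * (tDeriv n)^[k] φ (dilate n a b z) := by
  induction k with
  | zero => simp
  | succ k ih =>
    rw [Function.iterate_succ_apply', ih, Function.iterate_succ_apply']
    funext z
    simp only [tDeriv, dilate]
    rw [deriv_const_mul_field,
      deriv_comp_mul_left b (fun s => (tDeriv n)^[k] φ (a • z.1, s)) z.2, smul_eq_mul]
    ring

lemma spDeriv_const_mul_dilate (a b c : ℝ) (φ : Spc n × ℝ → ℝ) (i : Fin n) :
    spDeriv n i (fun z => c * φ (dilate n a b z))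
      = fun z => (c * a) * spDeriv n i φ (dilate n a b z) := by
  funext z
  simp only [spDeriv, dilate]
  rw [deriv_const_mul_field]
  have h := deriv_comp_mul_left a
    (fun s => φ (a • z.1 + s • EuclideanSpace.single i (1 : ℝ), b * z.2)) 0
  simp only [smul_add, smul_smul, mul_zero, smul_eq_mul] at h ⊢
  rw [h]
  ring

lemma iterate_spDeriv_const_mul_dilate (a b c : ℝ) (φ : Spc n × ℝ → ℝ) (i : Fin n) (j : ℕ) :
    (spDeriv n i)^[j] (fun z => c * φ (dilate n a b z))
      = fun z => (c * a ^ j) * (spDeriv n i)^[j] φ (dilate n a b z) := by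
  induction j with
  | zero => simp
  | succ j ih =>
    rw [Function.iterate_succ_apply', ih, spDeriv_const_mul_dilate, Function.iterate_succ_apply']
    funext z
    ring

lemma mDeriv_dilate (a b : ℝ) (φ : Spc n × ℝ → ℝ) (α : Fin n → ℕ) :
    mDeriv n α (fun z => φ (dilate n a b z))
      = fun z => a ^ (∑ i, α i) * mDeriv n α φ (dilate n a b z) := by
  have key : ∀ l : List (Fin n),
      l.foldr (fun i ψ => (spDeriv n i)^[α i] ψ) (fun z => φ (dilate n a b z))
        = fun z => a ^ (l.map α).sum
            * l.foldr (fun i ψ => (spDeriv n i)^[α i] ψ) φ (dilate n a b z) := by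
    intro l
    induction l with
    | nil => simp
    | cons i l ih =>
      simp only [List.foldr_cons, ih, List.map_cons, List.sum_cons]
      rw [iterate_spDeriv_const_mul_dilate]
      funext z
      ring
  rw [mDeriv, key, ← List.ofFn_eq_map, List.sum_ofFn]
  rfl

lemma IsTestFun.fderiv_apply {φ : Spc n × ℝ → ℝ} (h : IsTestFun n φ) (v : Spc n × ℝ) :
    IsTestFun n (fun z => fderiv ℝ φ z v) :=
  ⟨(h.1.fderiv_right (by norm_cast)).clm_apply contDiff_const, h.2.fderiv_apply ℝ v⟩

lemma IsTestFun.tDeriv {φ : Spc n × ℝ → ℝ} (h : IsTestFun n φ) : IsTestFun n (tDeriv n φ) := by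
  convert h.fderiv_apply ((0 : Spc n), (1 : ℝ)) using 1
  funext z
  have h1 : HasFDerivAt φ (fderiv ℝ φ z) (z.1, z.2) :=
    (h.1.differentiable (by simp) z).hasFDerivAt
  exact (h1.comp_hasDerivAt z.2 ((hasDerivAt_const z.2 z.1).prodMk (hasDerivAt_id z.2))).deriv

lemma IsTestFun.spDeriv {φ : Spc n × ℝ → ℝ} (h : IsTestFun n φ) (i : Fin n) :
    IsTestFun n (spDeriv n i φ) := by
  convert h.fderiv_apply (EuclideanSpace.single i (1 : ℝ), (0 : ℝ)) using 1
  funext z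
  have h1 : HasFDerivAt φ (fderiv ℝ φ z)
      (z.1 + (0 : ℝ) • EuclideanSpace.single i (1 : ℝ), z.2) := by
    simpa using (h.1.differentiable (by simp) z).hasFDerivAt
  have h2 : HasDerivAt (fun s : ℝ => z.1 + s • EuclideanSpace.single i (1 : ℝ))
      (EuclideanSpace.single i (1 : ℝ)) 0 := by
    simpa using ((hasDerivAt_id (0 : ℝ)).smul_const (EuclideanSpace.single i (1 : ℝ))).const_add z.1
  exact (h1.comp_hasDerivAt (0 : ℝ) (h2.prodMk (hasDerivAt_const (0 : ℝ) z.2))).deriv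

lemma IsTestFun.iterate {T : (Spc n × ℝ → ℝ) → Spc n × ℝ → ℝ}
    (hT : ∀ φ, IsTestFun n φ → IsTestFun n (T φ)) {φ : Spc n × ℝ → ℝ} (h : IsTestFun n φ)
    (k : ℕ) : IsTestFun n (T^[k] φ) := by
  induction k with
  | zero => exact h
  | succ k ih => rw [Function.iterate_succ_apply']; exact hT _ ih

lemma IsTestFun.mDeriv {φ : Spc n × ℝ → ℝ} (h : IsTestFun n φ) (α : Fin n → ℕ) :
    IsTestFun n (mDeriv n α φ) := by
  unfold _root_.mDeriv
  induction List.finRange n with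
  | nil => exact h
  | cons i l ih => exact ih.iterate (fun ψ hψ => hψ.spDeriv i) (α i)

lemma IsTestFun.exists_bound {φ : Spc n × ℝ → ℝ} (h : IsTestFun n φ) :
    ∃ C : ℝ, ∀ z, |φ z| ≤ C :=
  h.2.exists_bound_of_continuous h.1.continuous

/-- Time derivatives vanish where the function does not depend on time. -/
lemma iterate_tDeriv_eq_zero {U : Set (Spc n × ℝ)} (hU : IsOpen U) {φ : Spc n × ℝ → ℝ}
    {c : Spc n → ℝ} (hφ : ∀ z ∈ U, φ z = c z.1) {k : ℕ} (hk : 1 ≤ k) :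
    ∀ z ∈ U, (tDeriv n)^[k] φ z = 0 := by
  have step : ∀ (ψ : Spc n × ℝ → ℝ) (d : Spc n → ℝ), (∀ z ∈ U, ψ z = d z.1) →
      ∀ z ∈ U, tDeriv n ψ z = 0 := by
    intro ψ d h z hz
    have hev : (fun s : ℝ => ψ (z.1, s)) =ᶠ[nhds z.2] fun _ => d z.1 := by
      have : Continuous fun s : ℝ => (z.1, s) := by fun_prop
      filter_upwards [(hU.preimage this).mem_nhds hz] with s hs using h _ hs
    simp [tDeriv, hev.deriv_eq]
  induction k, hk using Nat.le_induction with
  | base => exact step φ c hφ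
  | succ k _ ih =>
    rw [Function.iterate_succ_apply']
    exact step _ (fun _ => 0) ih

/-- Spatial derivatives of positive order vanish where the function is locally constant. -/
lemma mDeriv_eq_zero {U : Set (Spc n × ℝ)} (hU : IsOpen U) {φ : Spc n × ℝ → ℝ}
    {c : ℝ} (hφ : ∀ z ∈ U, φ z = c) {α : Fin n → ℕ} (hα : 1 ≤ ∑ i, α i) :
    ∀ z ∈ U, mDeriv n α φ z = 0 := by
  have step : ∀ (i : Fin n) (ψ : Spc n × ℝ → ℝ) (d : ℝ), (∀ z ∈ U, ψ z = d) →
      ∀ z ∈ U, spDeriv n i ψ z = 0 := by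
    intro i ψ d h z hz
    have hev : (fun s : ℝ => ψ (z.1 + s • EuclideanSpace.single i (1 : ℝ), z.2))
        =ᶠ[nhds 0] fun _ => d := by
      have : Continuous fun s : ℝ =>
          (z.1 + s • EuclideanSpace.single i (1 : ℝ), z.2) := by fun_prop
      filter_upwards [(hU.preimage this).mem_nhds (by simpa using hz)] with s hs using h _ hs
    simp [spDeriv, hev.deriv_eq]
  have iter : ∀ (i : Fin n) (ψ : Spc n × ℝ → ℝ) (d : ℝ), (∀ z ∈ U, ψ z = d) →
      ∀ j : ℕ, ∀ z ∈ U, (spDeriv n i)^[j] ψ z = if j = 0 then d else 0 := by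
    intro i ψ d h j
    induction j with
    | zero => simpa using h
    | succ j ih =>
      rw [Function.iterate_succ_apply']
      simpa using step i _ _ ih
  have key : ∀ l : List (Fin n), ∀ z ∈ U,
      l.foldr (fun i ψ => (spDeriv n i)^[α i] ψ) φ z = if (l.map α).sum = 0 then c else 0 := by
    intro l
    induction l with
    | nil => simpa using hφ
    | cons i l ih =>
      intro z hz
      rw [List.foldr_cons, iter i _ _ ih (α i) z hz]
      by_cases h : α i = 0 <;> simp [h]
  intro z hz
  have h := key (List.finRange n) z hz
  rw [← List.ofFn_eq_map, List.sum_ofFn, if_neg (by omega)] at h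
  exact h

end Derivatives

/-- A cutoff function equal to `1` on `B_{1/2} × (-2^{-κ}, 2^{-κ})`, supported well inside
`B_1 × (-1, 1)`, and independent of time near `t = 0`. -/
lemma exists_cutoff (n : ℕ) {κ : ℝ} (hκ : 0 < κ) :
    ∃ (φ : Spc n × ℝ → ℝ) (ρ : ℝ), ρ < 1 ∧ IsTestFun n φ ∧ (∀ z, 0 ≤ φ z) ∧ (∀ z, φ z ≤ 1) ∧
      (∀ z, ‖z.1‖ < 1 / 2 → |z.2| < (1 / 2 : ℝ) ^ κ → φ z = 1) ∧
      (∀ z, |z.2| < (1 / 2 : ℝ) ^ κ → φ z = φ (z.1, 0)) ∧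
      (∀ z, ρ < ‖z.1‖ ∨ ρ < |z.2| → φ z = 0) := by
  have h0 : 0 < (1 / 2 : ℝ) ^ κ := by positivity
  have h1 : (1 / 2 : ℝ) ^ κ < 1 := Real.rpow_lt_one (by norm_num) (by norm_num) hκ
  let g : ContDiffBump (0 : Spc n) := ⟨1 / 2, 3 / 4, by norm_num, by norm_num⟩
  let h : ContDiffBump (0 : ℝ) := ⟨(1 / 2 : ℝ) ^ κ, (1 + (1 / 2 : ℝ) ^ κ) / 2, h0, by linarith⟩
  have hg1 : ∀ x : Spc n, ‖x‖ < 1 / 2 → g x = 1 := fun x hx =>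
    g.one_of_mem_closedBall (by simpa [g] using hx.le)
  have hh1 : ∀ t : ℝ, |t| < (1 / 2 : ℝ) ^ κ → h t = 1 := fun t ht =>
    h.one_of_mem_closedBall (by simpa [h] using ht.le)
  have hzero : ∀ z : Spc n × ℝ, max (3 / 4) ((1 + (1 / 2 : ℝ) ^ κ) / 2) < ‖z.1‖ ∨
      max (3 / 4) ((1 + (1 / 2 : ℝ) ^ κ) / 2) < |z.2| → g z.1 * h z.2 = 0 := by
    rintro z (hz | hz)
    · rw [g.zero_of_le_dist, zero_mul]
      rw [dist_zero_right]
      exact (le_max_left _ _).trans hz.le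
    · rw [h.zero_of_le_dist, mul_zero]
      rw [dist_zero_right]
      exact (le_max_right _ _).trans hz.le
  refine ⟨fun z => g z.1 * h z.2, max (3 / 4) ((1 + (1 / 2 : ℝ) ^ κ) / 2),
    max_lt (by norm_num) (by linarith), ⟨?_, ?_⟩, fun z => mul_nonneg g.nonneg h.nonneg,
    fun z => mul_le_one₀ g.le_one h.nonneg h.le_one, ?_, ?_, hzero⟩
  · exact (g.contDiff.comp contDiff_fst).mul (h.contDiff.comp contDiff_snd)
  · refine HasCompactSupport.intro
      ((isCompact_closedBall (0 : Spc n) (max (3 / 4) ((1 + (1 / 2 : ℝ) ^ κ) / 2))).prod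
        (isCompact_closedBall (0 : ℝ) (max (3 / 4) ((1 + (1 / 2 : ℝ) ^ κ) / 2)))) fun z hz => ?_
    apply hzero
    rw [Set.mem_prod, not_and_or] at hz
    simpa only [Metric.mem_closedBall, dist_zero_right, not_le, Real.norm_eq_abs] using hz
  · intro z hz ht
    simp [hg1 _ hz, hh1 _ ht]
  · intro z ht
    simp [hh1 _ ht, hh1 0 (by simpa using h0)]

section Nonlinearity

variable {p : ℝ} {f : ℝ → ℝ}

lemma ConvexOn.continuousOn_Ici_of_monotoneOn {g : ℝ → ℝ} (hg : ConvexOn ℝ (Ici 0) g)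
    (hm : MonotoneOn g (Ici 0)) : ContinuousOn g (Ici 0) := by
  intro x hx
  rcases eq_or_lt_of_le (show (0 : ℝ) ≤ x from hx) with rfl | hx0
  · have hlim : Tendsto (fun t : ℝ => (1 - t) * g 0 + t * g 1) (nhdsWithin 0 (Ici 0))
        (nhds (g 0)) := by
      have : Continuous fun t : ℝ => (1 - t) * g 0 + t * g 1 := by fun_prop
      simpa using (this.tendsto 0).mono_left nhdsWithin_le_nhds
    refine tendsto_of_tendsto_of_tendsto_of_le_of_le' tendsto_const_nhds hlim ?_ ?_
    · filter_upwards [self_mem_nhdsWithin] with t ht using hm self_mem_Ici ht ht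
    · filter_upwards [self_mem_nhdsWithin, mem_nhdsWithin_of_mem_nhds (Iio_mem_nhds one_pos)]
        with t ht ht1
      have ht1' : t < 1 := ht1
      simpa using hg.2 (self_mem_Ici (a := (0 : ℝ))) (show (1 : ℝ) ∈ Ici 0 by simp)
        (sub_nonneg.2 ht1'.le) ht (by ring)
  · have h := hg.continuousOn_interior
    rw [interior_Ici] at h
    exact (h.continuousAt (Ioi_mem_nhds hx0)).continuousWithinAt

lemma GoodF.nonneg (hf : GoodF p f) {ζ : ℝ} (hζ : 0 ≤ ζ) : 0 ≤ f ζ := by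
  obtain ⟨hm, hc, -, -, hpos⟩ := hf
  have hcont := hc.continuousOn_Ici_of_monotoneOn hm 0 self_mem_Ici
  have h0 : 0 ≤ f 0 := by
    refine ge_of_tendsto (hcont.mono_left (nhdsWithin_mono 0 Ioi_subset_Ici_self)) ?_
    filter_upwards [self_mem_nhdsWithin] with t ht using (hpos t ht).le
  exact h0.trans (hm self_mem_Ici hζ hζ)

end Nonlinearity

section Cylinders

variable {n : ℕ} {R κ : ℝ}

lemma measurableSet_cyl (n : ℕ) (r κ : ℝ) : MeasurableSet (cyl n r κ) :=
  measurableSet_ball.prod measurableSet_Ioo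

lemma mem_cyl {n : ℕ} {r κ : ℝ} {z : Spc n × ℝ} :
    z ∈ cyl n r κ ↔ ‖z.1‖ < r ∧ 0 < z.2 ∧ z.2 < r ^ κ := by
  simp [cyl, ball0]

lemma cyl_subset_halfSp (n : ℕ) (r κ : ℝ) : cyl n r κ ⊆ halfSp n := fun _ hz => (mem_cyl.1 hz).2.1

lemma half_rpow (hR : 0 < R) (κ : ℝ) : (R / 2) ^ κ = R ^ κ * (1 / 2 : ℝ) ^ κ := by
  rw [← Real.mul_rpow hR.le (by norm_num)]
  ring_nf

lemma cyl_half_subset (n : ℕ) (hR : 0 < R) (hκ : 0 < κ) : cyl n (R / 2) κ ⊆ cyl n R κ := by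
  intro z hz
  rw [mem_cyl] at hz ⊢
  exact ⟨by linarith [hz.1], hz.2.1,
    hz.2.2.trans_le (Real.rpow_le_rpow (by positivity) (by linarith) hκ.le)⟩

lemma cyl_subset_cyl_max_one (n : ℕ) (r κ : ℝ) : cyl n r κ ⊆ cyl n (max r (r ^ κ)) 1 := by
  intro z hz
  rw [mem_cyl] at hz ⊢
  rw [Real.rpow_one]
  exact ⟨hz.1.trans_le (le_max_left _ _), hz.2.1, hz.2.2.trans_le (le_max_right _ _)⟩

lemma integrableOn_cyl {g : Spc n × ℝ → ℝ}
    (hg : ∀ r : ℝ, 0 < r → IntegrableOn g (cyl n r 1)) (hR : 0 < R) (κ : ℝ) :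
    IntegrableOn g (cyl n R κ) :=
  (hg _ (hR.trans_le (le_max_left _ _))).mono_set (cyl_subset_cyl_max_one n R κ)

lemma volume_real_cyl (n : ℕ) {r : ℝ} (hr : 0 < r) (κ : ℝ) :
    (volume : Measure (Spc n × ℝ)).real (cyl n r κ)
      = (volume : Measure (Spc n)).real (Metric.ball 0 1) * r ^ ((n : ℝ) + κ) := by
  have hb : (volume : Measure (Spc n)).real (Metric.ball 0 r)
      = r ^ n * (volume : Measure (Spc n)).real (Metric.ball 0 1) := by
    rw [Measure.real, Measure.addHaar_ball_of_pos _ _ hr, ENNReal.toReal_mul,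
      ENNReal.toReal_ofReal (by positivity), finrank_euclideanSpace_fin]
    rfl
  rw [cyl, ball0, Measure.volume_eq_prod, measureReal_prod_prod, hb,
    Real.volume_real_Ioo_of_le (by positivity), Real.rpow_add hr, Real.rpow_natCast]
  ring

lemma volume_cyl_ne_top (n : ℕ) (r κ : ℝ) : (volume : Measure (Spc n × ℝ)) (cyl n r κ) ≠ ⊤ := by
  rw [cyl, ball0, Measure.volume_eq_prod, Measure.prod_prod]
  exact ENNReal.mul_ne_top measure_ball_lt_top.ne measure_Ioo_lt_top.ne

/-- The measure of `Q_R^κ \ Q_{R/2}^κ` is a fixed multiple of `R^{n+κ}`. -/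
lemma exists_volume_real_cyl_diff (n : ℕ) {κ : ℝ} (hκ : 0 < κ) :
    ∃ c : ℝ, 0 < c ∧ ∀ R : ℝ, 0 < R →
      (volume : Measure (Spc n × ℝ)).real (cyl n R κ \ cyl n (R / 2) κ)
        = c * R ^ ((n : ℝ) + κ) := by
  refine ⟨(volume : Measure (Spc n)).real (Metric.ball 0 1) * (1 - (1 / 2 : ℝ) ^ ((n : ℝ) + κ)),
    mul_pos ?_ (sub_pos.2 (Real.rpow_lt_one (by norm_num) (by norm_num) (by positivity))),
    fun R hR => ?_⟩
  · exact ENNReal.toReal_pos (Metric.measure_ball_pos _ _ one_pos).ne' measure_ball_lt_top.ne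
  · rw [measureReal_sdiff (cyl_half_subset n hR hκ) (measurableSet_cyl _ _ _)
      (volume_cyl_ne_top _ _ _), volume_real_cyl n hR, volume_real_cyl n (half_pos hR),
      half_rpow hR]
    ring

end Cylinders

section Energy

variable {n k m : ℕ} {A p κ R : ℝ}

lemma norm_dilate_fst (hR : 0 < R) (b : ℝ) (z : Spc n × ℝ) :
    ‖(dilate n R⁻¹ b z).1‖ = ‖z.1‖ / R := by
  simp [dilate, norm_smul, abs_of_pos hR, div_eq_inv_mul]

lemma abs_dilate_snd {T : ℝ} (hT : 0 < T) (a : ℝ) (z : Spc n × ℝ) :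
    |(dilate n a T⁻¹ z).2| = |z.2| / T := by
  simp [dilate, abs_mul, abs_of_pos hT, div_eq_inv_mul]

lemma dilate_mem_of_mem_cyl_half (hR : 0 < R) {z : Spc n × ℝ} (hz : z ∈ cyl n (R / 2) κ) :
    ‖(dilate n R⁻¹ (R ^ κ)⁻¹ z).1‖ < 1 / 2 ∧
      |(dilate n R⁻¹ (R ^ κ)⁻¹ z).2| < (1 / 2 : ℝ) ^ κ := by
  have hRκ : 0 < R ^ κ := by positivity
  obtain ⟨h1, h0, h2⟩ := mem_cyl.1 hz
  rw [half_rpow hR] at h2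
  rw [norm_dilate_fst hR, abs_dilate_snd hRκ, abs_of_pos h0, div_lt_iff₀ hR, div_lt_iff₀ hRκ]
  constructor <;> linarith

lemma dilate_mem_of_notMem_cyl (hR : 0 < R) {ρ : ℝ} (hρ : ρ < 1) {z : Spc n × ℝ}
    (hz : z ∈ halfSp n) (hzR : z ∉ cyl n R κ) :
    ρ < ‖(dilate n R⁻¹ (R ^ κ)⁻¹ z).1‖ ∨ ρ < |(dilate n R⁻¹ (R ^ κ)⁻¹ z).2| := by
  have hRκ : 0 < R ^ κ := by positivity
  have hz0 : 0 < z.2 := hz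
  rw [norm_dilate_fst hR, abs_dilate_snd hRκ, abs_of_pos hz0]
  by_contra! hcon
  exact hzR (mem_cyl.2 ⟨(div_lt_one hR).1 (hcon.1.trans_lt hρ), hz0,
    (div_lt_one hRκ).1 (hcon.2.trans_lt hρ)⟩)

lemma dilate_mem_of_notMem_annulus (hR : 0 < R) {ρ : ℝ} (hρ : ρ < 1) {z : Spc n × ℝ}
    (hz : z ∈ halfSp n) (hzD : z ∉ cyl n R κ \ cyl n (R / 2) κ) :
    (‖(dilate n R⁻¹ (R ^ κ)⁻¹ z).1‖ < 1 / 2 ∧ |(dilate n R⁻¹ (R ^ κ)⁻¹ z).2| < (1 / 2 : ℝ) ^ κ) ∨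
      (ρ < ‖(dilate n R⁻¹ (R ^ κ)⁻¹ z).1‖ ∨ ρ < |(dilate n R⁻¹ (R ^ κ)⁻¹ z).2|) := by
  rw [Set.mem_sdiff, not_and_not_right] at hzD
  by_cases hzR : z ∈ cyl n R κ
  · exact Or.inl (dilate_mem_of_mem_cyl_half hR (hzD hzR))
  · exact Or.inr (dilate_mem_of_notMem_cyl hR hρ hz hzR)

lemma norm_setIntegral_halfSp_le {D : Set (Spc n × ℝ)} (hD : MeasurableSet D)
    (hDs : D ⊆ halfSp n) {F g : Spc n × ℝ → ℝ} (hg : IntegrableOn g D)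
    (h : ∀ᵐ z ∂(volume.restrict (halfSp n)), |F z| ≤ D.indicator g z) :
    ‖∫ z in halfSp n, F z‖ ≤ ∫ z in D, g z := by
  refine (norm_integral_le_of_norm_le ((hg.integrable_indicator hD).integrableOn) h).trans_eq ?_
  rw [setIntegral_indicator hD, Set.inter_eq_right.2 hDs]

lemma measurableSet_halfSp (n : ℕ) : MeasurableSet (halfSp n) :=
  measurableSet_lt measurable_const measurable_snd

/-- Testing the inequality with a rescaled cutoff bounds the energy in `Q_{R/2}^κ` by lower order
integrals over `Q_R^κ \ Q_{R/2}^κ`. -/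
lemma exists_energy_le (n : ℕ) (hk : 1 ≤ k) (hm : 1 ≤ m) (hA : 0 < A) (p : ℝ) (hκ : 0 < κ) :
    ∃ M : ℝ, 0 ≤ M ∧
      ∀ (a : (Fin n → ℕ) → Spc n × ℝ → ℝ → ℝ) (f : ℝ → ℝ) (u0 : ℕ → Spc n → ℝ)
        (u : Spc n × ℝ → ℝ), Standing n k m A p a f u0 → IsGlobalWeakSol n k m p a f u0 u →
        ∀ R : ℝ, 0 < R →
          ∫ z in cyl n (R / 2) κ, f |u z| ≤
            M * ((R ^ κ)⁻¹ ^ k * (∫ z in cyl n R κ \ cyl n (R / 2) κ, |u z|)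
              + R⁻¹ ^ m * ∫ z in cyl n R κ \ cyl n (R / 2) κ, |u z| ^ p) := by
  obtain ⟨φ, ρ, hρ, hφ, hφ0, hφ1, hφU, hφW, hφV⟩ := exists_cutoff n hκ
  obtain ⟨Mt, hMt⟩ :=
    (hφ.iterate (T := tDeriv n) (fun ψ hψ => hψ.tDeriv) k).exists_bound
  choose Mx hMx using fun α => (hφ.mDeriv α).exists_bound
  have hMt0 : 0 ≤ Mt := (abs_nonneg _).trans (hMt 0)
  have hMx0 : ∀ α, 0 ≤ Mx α := fun α => (abs_nonneg _).trans (hMx α 0)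
  have hS0 : 0 ≤ ∑ α ∈ mIdx n m, A * Mx α :=
    Finset.sum_nonneg fun α _ => mul_nonneg hA.le (hMx0 α)
  refine ⟨max Mt (∑ α ∈ mIdx n m, A * Mx α), hMt0.trans (le_max_left _ _), ?_⟩
  rintro a f u0 u ⟨ha, hf, -, hu0, -, -⟩ ⟨hu, hup, hfu, hweak⟩ R hR
  have hRκ : 0 < R ^ κ := by positivity
  have hκ2 : 0 < (1 / 2 : ℝ) ^ κ := by positivity
  set S := dilate n R⁻¹ (R ^ κ)⁻¹ with hS
  set D := cyl n R κ \ cyl n (R / 2) κ with hD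
  have hDm : MeasurableSet D := (measurableSet_cyl _ _ _).diff (measurableSet_cyl _ _ _)
  have hDs : D ⊆ halfSp n := Set.sdiff_subset.trans (cyl_subset_halfSp n R κ)
  have hScont : ContDiff ℝ (⊤ : ℕ∞) S := by
    unfold S dilate
    fun_prop
  have hx : Continuous fun z : Spc n × ℝ => ‖z.1‖ := by fun_prop
  have ht : Continuous fun z : Spc n × ℝ => |z.2| := by fun_prop
  have hWo : IsOpen {z : Spc n × ℝ | |z.2| < (1 / 2 : ℝ) ^ κ} := isOpen_lt ht continuous_const
  have hUo : IsOpen {z : Spc n × ℝ | ‖z.1‖ < 1 / 2 ∧ |z.2| < (1 / 2 : ℝ) ^ κ} :=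
    (isOpen_lt hx continuous_const).inter hWo
  have hVo : IsOpen {z : Spc n × ℝ | ρ < ‖z.1‖ ∨ ρ < |z.2|} :=
    (isOpen_lt continuous_const hx).union (isOpen_lt continuous_const ht)
  have hcut : ∀ z ∈ halfSp n, z ∉ cyl n R κ → φ (S z) = 0 := fun z hz hzR =>
    hφV _ (dilate_mem_of_notMem_cyl hR hρ hz hzR)
  have hone : ∀ z ∈ cyl n (R / 2) κ, φ (S z) = 1 := fun z hz =>
    have h := dilate_mem_of_mem_cyl_half hR hz
    hφU _ h.1 h.2
  have hcompact : HasCompactSupport fun z => φ (S z) := by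
    refine HasCompactSupport.intro
      ((isCompact_closedBall (0 : Spc n) R).prod (isCompact_closedBall (0 : ℝ) (R ^ κ)))
      fun z hz => hφV _ ?_
    rw [Set.mem_prod, not_and_or] at hz
    simp only [Metric.mem_closedBall, dist_zero_right, not_le, Real.norm_eq_abs] at hz
    rw [hS, norm_dilate_fst hR, abs_dilate_snd hRκ]
    exact hz.imp (fun h => hρ.trans ((one_lt_div hR).2 h))
      (fun h => hρ.trans ((one_lt_div hRκ).2 h))
  have hw := hweak (fun z => φ (S z)) (hφ.1.comp hScont) hcompact fun z => hφ0 _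
  have hinit : 0 ≤ ∫ x : Spc n, ∑ i ∈ Finset.range k,
      (-1 : ℝ) ^ i * u0 (k - 1 - i) x * (tDeriv n)^[i] (fun z => φ (S z)) (x, 0) := by
    refine integral_nonneg_of_ae ?_
    filter_upwards [hu0] with x hx
    refine Finset.sum_nonneg fun i _ => ?_
    rcases Nat.eq_zero_or_pos i with rfl | hi
    · simpa using mul_nonneg hx (hφ0 _)
    · rw [hS, iterate_tDeriv_dilate]
      simp only
      rw [iterate_tDeriv_eq_zero hWo (c := fun x => φ (x, 0)) (fun z hz => hφW z hz) hi]
      · simp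
      · simpa [dilate] using hκ2
  have hen : ∫ z in cyl n (R / 2) κ, f |u z| ≤ ∫ z in halfSp n, f |u z| * φ (S z) := by
    have hint : IntegrableOn (fun z => f |u z| * φ (S z)) (cyl n R κ) := by
      simp_rw [mul_comm (f _)]
      refine (integrableOn_cyl hfu hR κ).bdd_mul (c := 1)
        (hφ.1.continuous.comp hScont.continuous).aestronglyMeasurable (ae_of_all _ fun z => ?_)
      rw [Real.norm_of_nonneg (hφ0 _)]
      exact hφ1 _
    have hnn : ∀ z, 0 ≤ f |u z| * φ (S z) := fun z =>
      mul_nonneg (hf.nonneg (abs_nonneg _)) (hφ0 _)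
    calc ∫ z in cyl n (R / 2) κ, f |u z| = ∫ z in cyl n (R / 2) κ, f |u z| * φ (S z) := by
          refine setIntegral_congr_fun (measurableSet_cyl _ _ _) fun z hz => ?_
          simp [hone z hz]
      _ ≤ ∫ z in cyl n R κ, f |u z| * φ (S z) :=
          setIntegral_mono_set hint (ae_of_all _ hnn) (cyl_half_subset n hR hκ).eventuallyLE
      _ = ∫ z in halfSp n, f |u z| * φ (S z) := by
          refine (setIntegral_eq_of_subset_of_forall_sdiff_eq_zero (measurableSet_halfSp n)
            (cyl_subset_halfSp n R κ) fun z hz => ?_).symm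
          simp [hcut z hz.1 hz.2]
  have htime : ‖∫ z in halfSp n, (-1 : ℝ) ^ k * u z * (tDeriv n)^[k] (fun z => φ (S z)) z‖
      ≤ ∫ z in D, Mt * (R ^ κ)⁻¹ ^ k * |u z| := by
    refine norm_setIntegral_halfSp_le hDm hDs
      (((integrableOn_cyl hu hR κ).mono_set Set.sdiff_subset).abs.const_mul _) ?_
    filter_upwards [ae_restrict_mem (measurableSet_halfSp n)] with z hz
    rw [hS, iterate_tDeriv_dilate]
    by_cases hzD : z ∈ D
    · rw [Set.indicator_of_mem hzD, abs_mul, abs_mul, abs_mul, abs_pow, abs_pow, abs_neg, abs_one,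
        one_pow, one_mul, abs_of_pos (inv_pos.2 hRκ)]
      have := mul_le_mul_of_nonneg_left (hMt (dilate n R⁻¹ (R ^ κ)⁻¹ z))
        (mul_nonneg (abs_nonneg (u z)) (pow_nonneg (inv_pos.2 hRκ).le k))
      linarith
    · rw [Set.indicator_of_notMem hzD]
      have h0 : (tDeriv n)^[k] φ (dilate n R⁻¹ (R ^ κ)⁻¹ z) = 0 := by
        rcases dilate_mem_of_notMem_annulus hR hρ hz hzD with h | h
        · exact iterate_tDeriv_eq_zero hUo (c := fun _ => 1) (fun z hz => hφU z hz.1 hz.2) hk _ h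
        · exact iterate_tDeriv_eq_zero hVo (c := fun _ => 0) hφV hk _ h
      simp [h0]
  have hspace : ‖∫ z in halfSp n, ∑ α ∈ mIdx n m,
        (-1 : ℝ) ^ m * a α z (u z) * mDeriv n α (fun z => φ (S z)) z‖
      ≤ ∫ z in D, (∑ α ∈ mIdx n m, A * Mx α) * R⁻¹ ^ m * |u z| ^ p := by
    refine norm_setIntegral_halfSp_le hDm hDs
      (((integrableOn_cyl hup hR κ).mono_set Set.sdiff_subset).const_mul _) ?_
    have hbd : ∀ᵐ z ∂(volume.restrict (halfSp n)), ∀ α ∈ mIdx n m,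
        |a α z (u z)| ≤ A * |u z| ^ p := by
      rw [Filter.eventually_all_finset]
      intro α hα
      filter_upwards [(ha α hα).2.2] with z hz using hz _
    filter_upwards [ae_restrict_mem (measurableSet_halfSp n), hbd] with z hz hzb
    have hdeg : ∀ α ∈ mIdx n m, ∑ i, α i = m := fun α hα => (Finset.mem_filter.1 hα).2
    by_cases hzD : z ∈ D
    · rw [Set.indicator_of_mem hzD, Finset.sum_mul, Finset.sum_mul]
      refine (Finset.abs_sum_le_sum_abs _ _).trans (Finset.sum_le_sum fun α hα => ?_)
      rw [hS, mDeriv_dilate, hdeg α hα, abs_mul, abs_mul, abs_mul, abs_pow, abs_pow, abs_neg,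
        abs_one, one_pow, one_mul, abs_of_pos (inv_pos.2 hR)]
      have := mul_le_mul (hzb α hα) (hMx α (dilate n R⁻¹ (R ^ κ)⁻¹ z)) (abs_nonneg _)
        (by positivity)
      have := mul_le_mul_of_nonneg_left this (pow_nonneg (inv_pos.2 hR).le m)
      linarith
    · rw [Set.indicator_of_notMem hzD, Finset.sum_eq_zero, abs_zero]
      intro α hα
      have h0 : mDeriv n α φ (dilate n R⁻¹ (R ^ κ)⁻¹ z) = 0 := by
        have hα1 : 1 ≤ ∑ i, α i := by rw [hdeg α hα]; exact hm
        rcases dilate_mem_of_notMem_annulus hR hρ hz hzD with h | h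
        · exact mDeriv_eq_zero hUo (fun z hz => hφU z hz.1 hz.2) hα1 _ h
        · exact mDeriv_eq_zero hVo hφV hα1 _ h
      simp [hS, mDeriv_dilate, h0]
  rw [integral_const_mul, Real.norm_eq_abs] at htime hspace
  have hI1 : 0 ≤ (R ^ κ)⁻¹ ^ k * ∫ z in D, |u z| :=
    mul_nonneg (by positivity) (integral_nonneg fun _ => abs_nonneg _)
  have hI2 : 0 ≤ R⁻¹ ^ m * ∫ z in D, |u z| ^ p :=
    mul_nonneg (by positivity) (integral_nonneg fun _ => by positivity)
  have h1 := mul_le_mul_of_nonneg_right (le_max_left Mt (∑ α ∈ mIdx n m, A * Mx α)) hI1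
  have h2 := mul_le_mul_of_nonneg_right (le_max_right Mt (∑ α ∈ mIdx n m, A * Mx α)) hI2
  have h3 := (abs_le.1 htime).2
  have h4 := (abs_le.1 hspace).1
  linarith

end Energy

/-- Power-mean inequality for set averages. -/
lemma setAverage_abs_le_rpow {X : Type*} [MeasurableSpace X] {μ : Measure X} {D : Set X} {p : ℝ}
    (hp : 1 ≤ p) (h0 : μ D ≠ 0) (hfin : μ D ≠ ⊤) {u : X → ℝ} (hu : IntegrableOn u D μ)
    (hup : IntegrableOn (fun z => |u z| ^ p) D μ) :
    ⨍ z in D, |u z| ∂μ ≤ (⨍ z in D, |u z| ^ p ∂μ) ^ (1 / p) := by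
  have hp0 : 0 < p := by linarith
  have h := (convexOn_rpow hp).map_set_average_le
    (Real.continuous_rpow_const hp0.le).continuousOn isClosed_Ici h0 hfin
    (ae_of_all _ fun z => abs_nonneg (u z)) hu.abs hup
  have hnn : 0 ≤ ⨍ z in D, |u z| ∂μ := by
    rw [setAverage_eq]
    exact mul_nonneg (by positivity) (integral_nonneg fun _ => abs_nonneg _)
  rw [one_div]
  exact (Real.le_rpow_inv_iff_of_pos hnn
    ((Real.rpow_nonneg hnn p).trans h) hp0).2 h

/-- Jensen's inequality for the convex function `ζ ↦ f (ζ ^ (1 / p))`. -/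
lemma GoodF.map_setAverage_le {X : Type*} [MeasurableSpace X] {μ : Measure X} {D : Set X}
    {p : ℝ} {f : ℝ → ℝ} (hf : GoodF p f) (hp : 0 < p) (h0 : μ D ≠ 0) (hfin : μ D ≠ ⊤) {u : X → ℝ}
    (hup : IntegrableOn (fun z => |u z| ^ p) D μ) (hfu : IntegrableOn (fun z => f |u z|) D μ) :
    f ((⨍ z in D, |u z| ^ p ∂μ) ^ (1 / p)) ≤ ⨍ z in D, f |u z| ∂μ := by
  obtain ⟨-, -, hm, hc, -⟩ := hf
  have e : ∀ z, f ((|u z| ^ p) ^ (1 / p)) = f |u z| := fun z => by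
    rw [one_div, Real.rpow_rpow_inv (abs_nonneg _) hp.ne']
  have h := hc.map_set_average_le (hc.continuousOn_Ici_of_monotoneOn hm) isClosed_Ici h0 hfin
    (ae_of_all _ fun z => Real.rpow_nonneg (abs_nonneg (u z)) p) hup
    (by simpa only [Function.comp_def, e] using hfu)
  simpa only [e] using h

/-- **Lemma 3.8.** Let `p ≥ 1` and `E(r) = ∫_{Q_r^κ} f(|u|)`. For every `κ > 0` there
are `C, σ > 0`, depending only on `A, k, m, n, p, κ`, such that for every global weak
solution `u` and all `R > 0` at least one of the two systems of inequalities
(3.8.1), (3.8.2) holds. -/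
theorem lemma_3_8
    (n k m : ℕ) (hn : 1 ≤ n) (hk : 1 ≤ k) (hm : 1 ≤ m)
    (A p : ℝ) (hA : 0 < A) (hp : 1 ≤ p) (κ : ℝ) (hκ : 0 < κ) :
    ∃ C σ : ℝ, 0 < C ∧ 0 < σ ∧
      ∀ (a : (Fin n → ℕ) → Spc n × ℝ → ℝ → ℝ) (f : ℝ → ℝ) (u0 : ℕ → Spc n → ℝ)
        (u : Spc n × ℝ → ℝ), Standing n k m A p a f u0 →
        IsGlobalWeakSol n k m p a f u0 u →
        ∀ R : ℝ, 0 < R →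
        ∀ E : ℝ → ℝ, (∀ r : ℝ, E r = ∫ z in cyl n r κ, f |u z|) →
        ∀ v : ℝ,
          v = (volume (cyl n R κ \ cyl n (R / 2) κ)).toReal⁻¹
              * ∫ z in cyl n R κ \ cyl n (R / 2) κ, |u z| ^ p →
          (σ * E (R / 2) / R ^ ((n : ℝ) - ((k : ℝ) - 1) * κ) ≤ v ^ (1 / p) ∧
            C * (R ^ ((n : ℝ) + κ)
                * f (σ * E (R / 2) / R ^ ((n : ℝ) - ((k : ℝ) - 1) * κ)))
              ≤ E R - E (R / 2)) ∨
          (σ * E (R / 2) / R ^ ((n : ℝ) + κ - (m : ℝ)) ≤ v ∧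
            C * (R ^ ((n : ℝ) + κ)
                * f ((σ * E (R / 2) / R ^ ((n : ℝ) + κ - (m : ℝ))) ^ (1 / p)))
              ≤ E R - E (R / 2)) := by
  obtain ⟨M, hM0, hM⟩ := exists_energy_le (A := A) n hk hm hA p hκ
  obtain ⟨c, hc, hvol⟩ := exists_volume_real_cyl_diff n hκ
  have hp0 : 0 < p := by linarith
  have hB : 0 < 2 * (M * c + 1) := by positivity
  refine ⟨c, (2 * (M * c + 1))⁻¹, hc, inv_pos.2 hB, ?_⟩
  intro a f u0 u hst hsol R hR E hE v hv
  have hf : GoodF p f := hst.2.1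
  have hen := hM a f u0 u hst hsol R hR
  obtain ⟨hu, hup, hfu, -⟩ := hsol
  rw [← hE] at hen
  set D := cyl n R κ \ cyl n (R / 2) κ with hD
  set e := E (R / 2) with he
  have hDR : 0 < (volume : Measure (Spc n × ℝ)).real D := by rw [hvol R hR]; positivity
  have hD0 : (volume : Measure (Spc n × ℝ)) D ≠ 0 := (ENNReal.toReal_pos_iff.1 hDR).1.ne'
  have hDfin : (volume : Measure (Spc n × ℝ)) D ≠ ⊤ := (ENNReal.toReal_pos_iff.1 hDR).2.ne
  have huD : IntegrableOn u D := (integrableOn_cyl hu hR κ).mono_set Set.sdiff_subset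
  have hupD : IntegrableOn (fun z => |u z| ^ p) D :=
    (integrableOn_cyl hup hR κ).mono_set Set.sdiff_subset
  have hfuD : IntegrableOn (fun z => f |u z|) D :=
    (integrableOn_cyl hfu hR κ).mono_set Set.sdiff_subset
  have hvavg : v = ⨍ z in D, |u z| ^ p := by rw [setAverage_eq, hv]; rfl
  have hv0 : 0 ≤ v := by
    rw [hv]
    exact mul_nonneg (by positivity) (integral_nonneg fun _ => by positivity)
  have he0 : 0 ≤ e := by
    rw [he, hE]
    exact integral_nonneg fun _ => hf.nonneg (abs_nonneg _)
  have hmean : ∫ z in D, |u z| ≤ c * R ^ ((n : ℝ) + κ) * v ^ (1 / p) := by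
    have h := setAverage_abs_le_rpow hp hD0 hDfin huD hupD
    rw [← hvavg, setAverage_eq, smul_eq_mul, inv_mul_le_iff₀ hDR, hvol R hR] at h
    exact h
  have hpint : ∫ z in D, |u z| ^ p = c * R ^ ((n : ℝ) + κ) * v := by
    rw [hvavg, setAverage_eq, smul_eq_mul, ← hvol R hR, mul_inv_cancel_left₀ hDR.ne']
  have hjensen : c * (R ^ ((n : ℝ) + κ) * f (v ^ (1 / p))) ≤ E R - e := by
    have h := hf.map_setAverage_le hp0 hD0 hDfin hupD hfuD
    rw [← hvavg, setAverage_eq, smul_eq_mul, le_inv_mul_iff₀ hDR, hvol R hR] at h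
    rw [he, hE, hE, ← setIntegral_sdiff (measurableSet_cyl _ _ _) (integrableOn_cyl hfu hR κ)
      (cyl_half_subset n hR hκ)]
    linarith
  have hpow1 : (R ^ κ)⁻¹ ^ k * R ^ ((n : ℝ) + κ) = R ^ ((n : ℝ) - ((k : ℝ) - 1) * κ) := by
    rw [← Real.rpow_neg hR.le, ← Real.rpow_natCast, ← Real.rpow_mul hR.le, ← Real.rpow_add hR]
    ring_nf
  have hpow2 : R⁻¹ ^ m * R ^ ((n : ℝ) + κ) = R ^ ((n : ℝ) + κ - (m : ℝ)) := by
    rw [Real.rpow_sub hR, Real.rpow_natCast, inv_pow]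
    ring
  set P := R ^ ((n : ℝ) - ((k : ℝ) - 1) * κ) with hP
  set Q := R ^ ((n : ℝ) + κ - (m : ℝ)) with hQ
  have hP0 : 0 < P := by positivity
  have hQ0 : 0 < Q := by positivity
  have hw0 : 0 ≤ v ^ (1 / p) := by positivity
  have hmain : e ≤ (M * c + 1) * (P * v ^ (1 / p) + Q * v) := by
    have h1 : (R ^ κ)⁻¹ ^ k * ∫ z in D, |u z| ≤ c * (P * v ^ (1 / p)) := by
      rw [← hpow1]
      have := mul_le_mul_of_nonneg_left hmean
        (show 0 ≤ (R ^ κ)⁻¹ ^ k by positivity)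
      linarith
    have h2 : R⁻¹ ^ m * ∫ z in D, |u z| ^ p = c * (Q * v) := by
      rw [← hpow2, hpint]
      ring
    have h3 := mul_le_mul_of_nonneg_left (add_le_add h1 h2.le) hM0
    have h4 : 0 ≤ P * v ^ (1 / p) + Q * v := by positivity
    linarith
  have hR0 : 0 ≤ c * R ^ ((n : ℝ) + κ) := by positivity
  have conclude : ∀ s, 0 ≤ s → s ≤ v ^ (1 / p) →
      c * (R ^ ((n : ℝ) + κ) * f s) ≤ E R - e := fun s hs hsv => by
    have := mul_le_mul_of_nonneg_left (hf.1 hs (hs.trans hsv) hsv) hR0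
    linarith
  rcases le_total (Q * v) (P * v ^ (1 / p)) with h | h
  · left
    have h1 : (2 * (M * c + 1))⁻¹ * e / P ≤ v ^ (1 / p) := by
      rw [div_le_iff₀ hP0, inv_mul_le_iff₀ hB]
      nlinarith
    exact ⟨h1, conclude _ (by positivity) h1⟩
  · right
    have h1 : (2 * (M * c + 1))⁻¹ * e / Q ≤ v := by
      rw [div_le_iff₀ hQ0, inv_mul_le_iff₀ hB]
      nlinarith
    have h2 : 0 ≤ (2 * (M * c + 1))⁻¹ * e / Q := by positivity
    exact ⟨h1, conclude _ (by positivity) (Real.rpow_le_rpow h2 h1 (by positivity))⟩
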